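/- Let P be the Pell sequence (P_0 = 0, P_1 = 1, P_n = 2P_{n-1} + P_{n-2}), Q the associated Pell sequence (Q_0 = 1, Q_1 = 1, Q_n = 2Q_{n-1} + Q_{n-2}), B the balancing sequence (B_0 = 0, B_1 = 1, B_n = 6B_{n-1} − B_{n-2}), and b the cobalancing sequence (b_0 = 0, b_1 = 0, b_n = 6b_{n-1} − b_{n-2} + 2). For every k ≥ 1, the greatest common divisor of the set { Σ_{i=1}^{k} b_{n+i} : n ≥ 0 } of all sums of k consecutive cobalancing numbers equals gcd((B_k − k)/2, P_k) if k is even, and equals gcd((B_k − k)/2, 2·Q_k) if k is odd. -/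

import Mathlib

/-- The Pell sequence: P₀ = 0, P₁ = 1, Pₙ = 2Pₙ₋₁ + Pₙ₋₂. -/
def pell : ℕ → ℤ
  | 0 => 0
  | 1 => 1
  | n + 2 => 2 * pell (n + 1) + pell n

/-- The associated Pell sequence: Q₀ = 1, Q₁ = 1, Qₙ = 2Qₙ₋₁ + Qₙ₋₂. -/
def assocPell : ℕ → ℤ
  | 0 => 1
  | 1 => 1
  | n + 2 => 2 * assocPell (n + 1) + assocPell n

/-- The balancing sequence: B₀ = 0, B₁ = 1, Bₙ = 6Bₙ₋₁ − Bₙ₋₂. -/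
def balancing : ℕ → ℤ
  | 0 => 0
  | 1 => 1
  | n + 2 => 6 * balancing (n + 1) - balancing n

/-- The cobalancing sequence: b₀ = 0, b₁ = 0, bₙ = 6bₙ₋₁ − bₙ₋₂ + 2. -/
def cobalancing : ℕ → ℤ
  | 0 => 0
  | 1 => 0
  | n + 2 => 6 * cobalancing (n + 1) - cobalancing n + 2

/-- `d` is the greatest common divisor of the set `{S n : n ≥ 0}`: `d ≥ 0`, `d` divides
every element of the set, and every common divisor of the set divides `d`. -/
def IsSetGCD (S : ℕ → ℤ) (d : ℤ) : Prop :=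
  0 ≤ d ∧ (∀ n : ℕ, d ∣ S n) ∧ ∀ e : ℤ, (∀ n : ℕ, e ∣ S n) → e ∣ d

theorem two_mul_cobalancing_succ (n : ℕ) :
    2 * cobalancing (n + 1) = balancing (n + 1) - balancing n - 1 := by
  induction n using Nat.twoStepInduction with
  | zero => decide
  | one => decide
  | more n h₀ h₁ =>
    have hb : cobalancing (n + 3) = 6 * cobalancing (n + 2) - cobalancing (n + 1) + 2 := rfl
    have h₃ : balancing (n + 3) = 6 * balancing (n + 2) - balancing (n + 1) := rfl
    have h₂ : balancing (n + 2) = 6 * balancing (n + 1) - balancing n := rfl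
    simp only [Nat.add_assoc, Nat.reduceAdd] at h₀ h₁ ⊢
    linarith

theorem pell_two_mul_and_succ (n : ℕ) :
    pell (2 * n) = 2 * balancing n ∧ pell (2 * n + 1) = balancing (n + 1) - balancing n := by
  induction n with
  | zero => decide
  | succ n ih =>
    have h₂ : pell (2 * n + 2) = 2 * pell (2 * n + 1) + pell (2 * n) := rfl
    have h₃ : pell (2 * n + 3) = 2 * pell (2 * n + 2) + pell (2 * n + 1) := rfl
    have hB : balancing (n + 2) = 6 * balancing (n + 1) - balancing n := rfl
    change pell (2 * n + 2) = _ ∧ pell (2 * n + 3) = balancing (n + 2) - _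
    constructor <;> linarith [ih.1, ih.2]

theorem assocPell_two_mul_and_succ (n : ℕ) :
    assocPell (2 * n) = balancing (n + 1) - 3 * balancing n ∧
      assocPell (2 * n + 1) = balancing (n + 1) + balancing n := by
  induction n with
  | zero => decide
  | succ n ih =>
    have h₂ : assocPell (2 * n + 2) = 2 * assocPell (2 * n + 1) + assocPell (2 * n) := rfl
    have h₃ : assocPell (2 * n + 3) = 2 * assocPell (2 * n + 2) + assocPell (2 * n + 1) := rfl
    have hB : balancing (n + 2) = 6 * balancing (n + 1) - balancing n := rfl
    change assocPell (2 * n + 2) = balancing (n + 2) - _ ∧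
      assocPell (2 * n + 3) = balancing (n + 2) + _
    constructor <;> linarith [ih.1, ih.2]

theorem balancing_succ_sq_add_sq (n : ℕ) :
    balancing (n + 1) ^ 2 - 6 * balancing n * balancing (n + 1) + balancing n ^ 2 = 1 := by
  induction n with
  | zero => decide
  | succ n ih =>
    have hB : balancing (n + 1 + 1) = 6 * balancing (n + 1) - balancing n := rfl
    rw [hB]
    linear_combination ih

theorem balancing_add_succ (m n : ℕ) :
    balancing (m + n + 1) =
      balancing (m + 1) * balancing (n + 1) - balancing m * balancing n := by
  induction n using Nat.twoStepInduction with
  | zero => simp [balancing]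
  | one => simp [balancing]; ring
  | more n h₀ h₁ =>
    have h₃ : balancing (m + (n + 2) + 1) =
        6 * balancing (m + (n + 1) + 1) - balancing (m + n + 1) := rfl
    have h₂ : balancing (n + 2 + 1) = 6 * balancing (n + 1 + 1) - balancing (n + 1) := rfl
    have hB : balancing (n + 2) = 6 * balancing (n + 1) - balancing n := rfl
    rw [h₃, h₁, h₀, h₂, hB]
    ring

theorem balancing_add (m n : ℕ) :
    balancing (m + n) = balancing (m + 1) * balancing n -
      balancing m * (6 * balancing n - balancing (n + 1)) := by
  have h₀ := balancing_add_succ m n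
  have h₁ : balancing (m + n + 2) =
      balancing (m + 1) * balancing (n + 2) - balancing m * balancing (n + 1) :=
    balancing_add_succ m (n + 1)
  have h₂ : balancing (m + n + 2) = 6 * balancing (m + n + 1) - balancing (m + n) := rfl
  have hB : balancing (n + 2) = 6 * balancing (n + 1) - balancing n := rfl
  rw [hB] at h₁
  linear_combination 6 * h₀ - h₁ + h₂

theorem cobalancing_add_two_mul_sub (n j : ℕ) :
    cobalancing (n + 2 * j + 1) - cobalancing (n + 1) =
      (balancing (n + j + 1) + balancing (n + j)) * pell (2 * j) := by
  have e₁ := two_mul_cobalancing_succ (n + 2 * j)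
  have e₂ := two_mul_cobalancing_succ n
  have hs : n + 2 * j = n + j + j := by ring
  rw [hs] at e₁ ⊢
  rw [balancing_add_succ (n + j) j, balancing_add (n + j) j, balancing_add_succ n j,
    balancing_add n j] at e₁
  rw [(pell_two_mul_and_succ j).1, balancing_add_succ n j, balancing_add n j]
  have hq := balancing_succ_sq_add_sq j
  apply mul_left_cancel₀ (two_ne_zero (α := ℤ))
  linear_combination e₁ - e₂ + (balancing (n + 1) - balancing n) * hq

theorem cobalancing_add_two_mul_succ_sub (n j : ℕ) :
    cobalancing (n + (2 * j + 1) + 1) - cobalancing (n + 1) =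
      balancing (n + j + 1) * (2 * assocPell (2 * j + 1)) := by
  have e₁ := two_mul_cobalancing_succ (n + (2 * j + 1))
  have e₂ := two_mul_cobalancing_succ n
  have hs : n + (2 * j + 1) = n + j + j + 1 := by ring
  have hB : balancing (n + j + j + 1 + 1) =
      6 * balancing (n + j + j + 1) - balancing (n + j + j) := rfl
  rw [hs] at e₁ ⊢
  rw [hB, balancing_add_succ (n + j) j, balancing_add (n + j) j, balancing_add_succ n j,
    balancing_add n j] at e₁
  rw [(assocPell_two_mul_and_succ j).2, balancing_add_succ n j]
  have hq := balancing_succ_sq_add_sq j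
  apply mul_left_cancel₀ (two_ne_zero (α := ℤ))
  linear_combination e₁ - e₂ + (balancing (n + 1) - balancing n) * hq

theorem sum_cobalancing (k : ℕ) :
    ∑ i ∈ Finset.Icc 1 k, cobalancing i = (balancing k - k) / 2 := by
  have h : 2 * ∑ i ∈ Finset.Icc 1 k, cobalancing i = balancing k - k := by
    induction k with
    | zero => decide
    | succ k ih =>
      rw [Finset.sum_Icc_succ_top (by omega)]
      push_cast
      linarith [two_mul_cobalancing_succ k]
  omega

theorem sum_Icc_add_succ_sub (f : ℕ → ℤ) (k n : ℕ) :
    ∑ i ∈ Finset.Icc 1 k, f (n + 1 + i) - ∑ i ∈ Finset.Icc 1 k, f (n + i) =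
      f (n + k + 1) - f (n + 1) := by
  induction k with
  | zero => simp
  | succ k ih =>
    rw [Finset.sum_Icc_succ_top (by omega), Finset.sum_Icc_succ_top (by omega)]
    have h₁ : n + 1 + (k + 1) = n + (k + 1) + 1 := by ring
    have h₂ : n + (k + 1) = n + k + 1 := by ring
    rw [h₁, h₂]
    linarith

/-- If the differences of `S` are multiples `c n * g` with `c 0` and `c 1` coprime, then the
greatest common divisor of the values of `S` is `gcd (S 0) g`. -/
theorem isSetGCD_gcd_of_sub_eq_mul {S c : ℕ → ℤ} {g : ℤ}
    (h : ∀ n, S (n + 1) - S n = c n * g) (hc : IsCoprime (c 0) (c 1)) :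
    IsSetGCD S (Int.gcd (S 0) g) := by
  refine ⟨by positivity, fun n => ?_, fun e he => Int.dvd_coe_gcd (he 0) ?_⟩
  · induction n with
    | zero => exact Int.gcd_dvd_left _ _
    | succ n ih =>
      rw [← sub_add_cancel (S (n + 1)) (S n), h]
      exact dvd_add (Dvd.dvd.mul_left (Int.gcd_dvd_right _ _) _) ih
  · obtain ⟨p, q, hpq⟩ := hc
    have hg : g = p * (S 1 - S 0) + q * (S 2 - S 1) := by
      linear_combination -g * hpq - p * h 0 - q * h 1
    rw [hg]
    exact dvd_add (Dvd.dvd.mul_left (dvd_sub (he 1) (he 0)) _)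
      (Dvd.dvd.mul_left (dvd_sub (he 2) (he 1)) _)

theorem gcd_sums_cobalancing_intermediate (k : ℕ) (hk : 1 ≤ k) :
    (Even k →
      IsSetGCD (fun n => ∑ i ∈ Finset.Icc 1 k, cobalancing (n + i))
        (Int.gcd ((balancing k - k) / 2) (pell k))) ∧
    (Odd k →
      IsSetGCD (fun n => ∑ i ∈ Finset.Icc 1 k, cobalancing (n + i))
        (Int.gcd ((balancing k - k) / 2) (2 * assocPell k))) := by
  have h₀ : (balancing k - k) / 2 = ∑ i ∈ Finset.Icc 1 k, cobalancing (0 + i) := by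
    simp only [zero_add, sum_cobalancing]
  rw [h₀]
  constructor
  · intro hk
    obtain ⟨j, rfl⟩ := hk.exists_two_nsmul
    rw [smul_eq_mul]
    refine isSetGCD_gcd_of_sub_eq_mul
      (S := fun n => ∑ i ∈ Finset.Icc 1 (2 * j), cobalancing (n + i))
      (c := fun n => balancing (n + j + 1) + balancing (n + j))
      (fun n => (sum_Icc_add_succ_sub _ _ _).trans (cobalancing_add_two_mul_sub n j)) ?_
    have hB : balancing (j + 1 + 1) = 6 * balancing (j + 1) - balancing j := rfl
    simp only [zero_add, add_comm 1 j, hB]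
    exact ⟨balancing (j + 1), -balancing j, by
      linear_combination balancing_succ_sq_add_sq j⟩
  · rintro ⟨j, rfl⟩
    refine isSetGCD_gcd_of_sub_eq_mul
      (S := fun n => ∑ i ∈ Finset.Icc 1 (2 * j + 1), cobalancing (n + i))
      (c := fun n => balancing (n + j + 1))
      (fun n => (sum_Icc_add_succ_sub _ _ _).trans (cobalancing_add_two_mul_succ_sub n j)) ?_
    have hB : balancing (j + 1 + 1) = 6 * balancing (j + 1) - balancing j := rfl
    simp only [zero_add, add_comm 1 j, hB]
    exact ⟨balancing (j + 1), -balancing j, by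
      linear_combination balancing_succ_sq_add_sq j⟩
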